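/- Let A be a finite nonempty set of positive integers and let p ≥ 1 satisfy w^A(n) = w^A(n + p) for all n ≥ 0. Then for every x ∈ A and every integer k ≥ 1: for all n ≥ 0, w^A(n) = 0 implies w^A(n − kp − x) = 1; consequently, if kp + x ∉ A then w^{A∪{kp+x}}(n) = w^A(n) for all n ≥ 0 (kp + x is an extension of A). -/

import Mathlib

open Classical in
/-- The winning sequence on ℕ, where `seed` gives values at negative positions. -/
noncomputable def subW (A : Set ℕ) (seed : ℤ → ℕ) : ℕ → ℕ := fun n =>
  Nat.strongRecOn n (fun n ih =>
    if ∃ x ∈ A, (if h : 0 < x ∧ x ≤ n then ih (n - x) (by omega)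
                 else seed ((n : ℤ) - (x : ℤ))) = 0
    then 1 else 0)

/-- The winning sequence `w^{A,seed} : ℤ → ℕ`. -/
noncomputable def W (A : Set ℕ) (seed : ℤ → ℕ) : ℤ → ℕ := fun n =>
  if 0 ≤ n then subW A seed n.toNat else seed n

/-- The trivial seed (all ones), giving the unseeded sequence `w^A`. -/
def one : ℤ → ℕ := fun _ => 1

/-- The seed function determined by a string `S ∈ {0,1}^L`: `w(-i) = S_i` for `1 ≤ i ≤ L`,
and `w(n) = 1` for `n < -L`. -/
def seedExt (L : ℕ) (S : ℕ → Bool) : ℤ → ℕ := fun j =>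
  if -(L : ℤ) ≤ j ∧ j < 0 then (if S ((-j).toNat - 1) then 1 else 0) else 1

/-- `w` is eventually periodic over `p`. -/
def PeriodicOver (w : ℤ → ℕ) (p : ℕ) : Prop :=
  ∃ N : ℕ, ∀ n : ℤ, (N : ℤ) ≤ n → w n = w (n + p)

/-- The (eventual) period: the least `p ≥ 1` over which `w` is eventually periodic. -/
noncomputable def per (w : ℤ → ℕ) : ℕ := sInf {p : ℕ | 0 < p ∧ PeriodicOver w p}

/-- The preperiod: the least `N` that works for `p = per w`. -/
noncomputable def preper (w : ℤ → ℕ) : ℕ :=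
  sInf {N : ℕ | ∀ n : ℤ, (N : ℤ) ≤ n → w n = w (n + per w)}

theorem W_of_neg (A : Set ℕ) (seed : ℤ → ℕ) {n : ℤ} (hn : n < 0) : W A seed n = seed n := by
  simp [W, not_le.mpr hn]

open Classical in
theorem subW_eq (A : Set ℕ) (seed : ℤ → ℕ) (n : ℕ) :
    subW A seed n =
      if ∃ x ∈ A, (if 0 < x ∧ x ≤ n then subW A seed (n - x)
        else seed ((n : ℤ) - (x : ℤ))) = 0 then 1 else 0 := by
  unfold subW
  rw [Nat.strongRecOn_eq]
  simp only [dite_eq_ite]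

open Classical in
/-- The defining recursion of the winning sequence, for positive moves. -/
theorem W_eq (A : Set ℕ) (hpos : ∀ x ∈ A, 0 < x) (seed : ℤ → ℕ) {n : ℤ} (hn : 0 ≤ n) :
    W A seed n = if ∃ x ∈ A, W A seed (n - x) = 0 then 1 else 0 := by
  lift n to ℕ using hn
  have move : ∀ x ∈ A, (if 0 < x ∧ x ≤ n then subW A seed (n - x)
      else seed ((n : ℤ) - (x : ℤ))) = W A seed ((n : ℤ) - x) := by
    intro x hx
    have hx0 := hpos x hx
    by_cases hxn : x ≤ n
    · rw [if_pos ⟨hx0, hxn⟩, W, if_pos (by omega)]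
      congr 1
      omega
    · rw [if_neg (by omega), W_of_neg A seed (by omega)]
  have key : (∃ x ∈ A, (if 0 < x ∧ x ≤ n then subW A seed (n - x)
      else seed ((n : ℤ) - (x : ℤ))) = 0) ↔ ∃ x ∈ A, W A seed ((n : ℤ) - x) = 0 :=
    exists_congr fun x => and_congr_right fun hx => by rw [move x hx]
  rw [W, if_pos (by omega), Int.toNat_natCast, subW_eq]
  simp only [key]

theorem W_one_eq_zero_or_one (A : Set ℕ) (hpos : ∀ x ∈ A, 0 < x) (n : ℤ) :
    W A one n = 0 ∨ W A one n = 1 := by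
  classical
  rcases lt_or_ge n 0 with hn | hn
  · exact Or.inr (W_of_neg A one hn)
  · rw [W_eq A hpos one hn]
    split_ifs <;> simp

theorem W_eq_one_of_move (A : Set ℕ) (hpos : ∀ x ∈ A, 0 < x) (seed : ℤ → ℕ) {n : ℤ}
    (hn : 0 ≤ n) {x : ℕ} (hx : x ∈ A) (h : W A seed (n - x) = 0) : W A seed n = 1 := by
  classical
  rw [W_eq A hpos seed hn, if_pos ⟨x, hx, h⟩]

/-- A move `y` that never joins two zeros of the unseeded winning sequence is an extension. -/
theorem W_insert_eq (A : Set ℕ) (hpos : ∀ x ∈ A, 0 < x) {y : ℕ} (hy : 0 < y)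
    (h : ∀ n : ℤ, 0 ≤ n → W A one n = 0 → W A one (n - y) = 1) (n : ℤ) :
    W (insert y A) one n = W A one n := by
  classical
  have hpos' : ∀ x ∈ insert y A, 0 < x := by
    rintro x (rfl | hx)
    exacts [hy, hpos x hx]
  rcases lt_or_ge n 0 with hn | hn
  · rw [W_of_neg _ _ hn, W_of_neg _ _ hn]
  lift n to ℕ using hn
  induction n using Nat.strong_induction_on with
  | _ n ih =>
    have prev : ∀ x : ℕ, 0 < x → W (insert y A) one ((n : ℤ) - x) = W A one ((n : ℤ) - x) := by
      intro x hx
      rcases lt_or_ge ((n : ℤ) - x) 0 with hn | hn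
      · rw [W_of_neg _ _ hn, W_of_neg _ _ hn]
      · have := ih (n - x) (by omega)
        rwa [Nat.cast_sub (by omega)] at this
    rcases W_one_eq_zero_or_one A hpos n with h0 | h1
    · rw [h0, W_eq _ hpos' one (by omega), if_neg]
      rintro ⟨x, hx, hx0⟩
      rw [prev x (hpos' x hx)] at hx0
      rcases hx with rfl | hx
      · have := h n (by omega) h0
        omega
      · have := W_eq_one_of_move A hpos one (by omega) hx hx0
        omega
    · rw [W_eq A hpos one (by omega)] at h1
      obtain ⟨x, hx, hx0⟩ : ∃ x ∈ A, W A one ((n : ℤ) - x) = 0 := by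
        by_contra hne
        simp [if_neg hne] at h1
      rw [← prev x (hpos x hx)] at hx0
      rw [W_eq_one_of_move _ hpos' one (by omega) (Set.mem_insert_of_mem y hx) hx0,
        W_eq A hpos one (by omega), h1]

theorem eq_add_mul_of_eq_add {w : ℤ → ℕ} {p : ℕ} (h : ∀ n : ℤ, 0 ≤ n → w n = w (n + p))
    (k : ℕ) {n : ℤ} (hn : 0 ≤ n) : w n = w (n + k * p) := by
  induction k with
  | zero => simp
  | succ k ih =>
    rw [ih, h _ (by positivity)]
    congr 1
    push_cast
    ring

/-- if `w^A` is purely periodic over `p`, then for `x ∈ A` and `k ≥ 1`,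
`w^A(n) = 0` implies `w^A(n - kp - x) = 1`; hence `kp + x` is an extension of `A`. -/
theorem stmt_6 (A : Finset ℕ) (hA : A.Nonempty) (hpos : ∀ x ∈ A, 0 < x)
    (p : ℕ) (hp : 1 ≤ p)
    (h : ∀ n : ℤ, 0 ≤ n → W ↑A one n = W ↑A one (n + p)) :
    ∀ x ∈ A, ∀ k : ℕ, 1 ≤ k →
      (∀ n : ℤ, 0 ≤ n → W ↑A one n = 0 →
        W ↑A one (n - (k : ℤ) * p - x) = 1) ∧
      (k * p + x ∉ A →
        ∀ n : ℤ, 0 ≤ n → W ↑(insert (k * p + x) A) one n = W ↑A one n) := by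
  intro x hx k _
  have hpos' : ∀ x ∈ (A : Set ℕ), 0 < x := fun x hx => hpos x (Finset.mem_coe.mp hx)
  have key : ∀ n : ℤ, 0 ≤ n → W ↑A one n = 0 → W ↑A one (n - (k : ℤ) * p - x) = 1 := by
    intro n hn hn0
    rcases lt_or_ge (n - (k : ℤ) * p - x) 0 with hm | hm
    · exact W_of_neg _ _ hm
    refine (W_one_eq_zero_or_one _ hpos' _).resolve_left fun hm0 => ?_
    rw [eq_add_mul_of_eq_add h k hm,
      show n - (k : ℤ) * p - x + k * p = n - x by ring] at hm0
    have := W_eq_one_of_move _ hpos' one hn (Finset.mem_coe.mpr hx) hm0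
    omega
  refine ⟨key, fun _ n _ => ?_⟩
  have hy : 0 < k * p + x := Nat.add_pos_right _ (hpos x hx)
  have := W_insert_eq (A : Set ℕ) hpos' hy (fun n hn hn0 => by
    have := key n hn hn0
    rwa [show n - ((k * p + x : ℕ) : ℤ) = n - (k : ℤ) * p - x by push_cast; ring]) n
  simpa using this
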